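/- Let T be a coded prae-dilator, X a linear order, and ϑ : D^T_X → X a Bachmann-Howard collapse. Then there is an order embedding of ϑ(T) into X; that is, ϑ(T) embeds into every Bachmann-Howard fixed point of T. (Explicitly, the map f : ϑ(T) → X defined recursively by f(ϑ_σ^{s₀,…,s_{n−1}}) := ϑ(⟨{f(s₀),…,f(s_{n−1})}, σ⟩) is strictly increasing.) -/

import Mathlib

structure PraeDilator where
  A : ℕ → Type
  inst : ∀ n, LinearOrder (A n)
  map : ∀ {n m : ℕ}, (Fin n ↪o Fin m) → A n → A m
  map_strictMono : ∀ {n m : ℕ} (f : Fin n ↪o Fin m) (σ τ : A n),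
      (inst n).lt σ τ → (inst m).lt (map f σ) (map f τ)
  map_id : ∀ (n : ℕ) (σ : A n), map (OrderIso.refl (Fin n)).toOrderEmbedding σ = σ
  map_comp : ∀ {n m k : ℕ} (f : Fin n ↪o Fin m) (g : Fin m ↪o Fin k) (σ : A n),
      map (f.trans g) σ = map g (map f σ)
  supp : ∀ n, A n → Finset (Fin n)
  supp_natural : ∀ {n m : ℕ} (f : Fin n ↪o Fin m) (σ : A n),
      supp m (map f σ) = (supp n σ).map f.toEmbedding
  supp_spec : ∀ (n : ℕ) (σ : A n),
      ∃ τ : A (supp n σ).card, map ((supp n σ).orderEmbOfFin rfl) τ = σ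

attribute [instance] PraeDilator.inst



/-- The strictly increasing map `Fin a.card ↪o Fin d.card` induced by an inclusion `a ⊆ d`. -/
def inclEmb {X : Type} [LinearOrder X] {a d : Finset X} (h : a ⊆ d) :
    Fin a.card ↪o Fin d.card :=
  OrderEmbedding.ofStrictMono
    (fun i => (d.orderIsoOfFin rfl).symm ⟨a.orderEmbOfFin rfl i, h (a.orderEmbOfFin_mem rfl i)⟩)
    (fun i j hij => by
      apply (d.orderIsoOfFin rfl).symm.strictMono
      exact Subtype.mk_lt_mk.mpr ((a.orderEmbOfFin rfl).strictMono hij))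

structure DApp (D : PraeDilator) (X : Type) [LinearOrder X] where
  a : Finset X
  σ : D.A a.card
  hsupp : D.supp a.card σ = Finset.univ

def DLt (D : PraeDilator) (X : Type) [LinearOrder X] (x y : DApp D X) : Prop :=
  D.map (inclEmb (Finset.subset_union_left : x.a ⊆ x.a ∪ y.a)) x.σ <
    D.map (inclEmb (Finset.subset_union_right : y.a ⊆ x.a ∪ y.a)) y.σ

/-- Terms of the notation system `ϑ(T)`: a term `ϑ_σ^{s₀,…,s_{n−1}}` consists of a finite
sequence of previously constructed terms together with an element `σ ∈ T_n`. -/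
inductive ThT (D : PraeDilator) : Type where
  | node (n : ℕ) (ss : Fin n → ThT D) (σ : D.A n) : ThT D

/-- Size of a term of `ϑ(T)`. -/
def tsizeT (D : PraeDilator) : ThT D → ℕ
  | .node _ ss _ => (Finset.univ.sum fun i => tsizeT D (ss i)) + 1

theorem tsizeT_lt (D : PraeDilator) (n : ℕ) (ss : Fin n → ThT D) (σ : D.A n) (i : Fin n) :
    tsizeT D (ss i) < tsizeT D (.node n ss σ) := by
  have : tsizeT D (ss i) ≤ Finset.univ.sum fun j => tsizeT D (ss j) :=
    Finset.single_le_sum (f := fun j => tsizeT D (ss j)) (fun _ _ => Nat.zero_le _) (Finset.mem_univ i)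
  calc tsizeT D (ss i) ≤ _ := this
    _ < _ + 1 := Nat.lt_succ_self _
    _ = tsizeT D (.node n ss σ) := by rw [tsizeT]

/-- The relation `<_{ϑ(T)}` on terms of `ϑ(T)`, following the simultaneous recursive
definition: `ϑ_σ^{s₀,…,s_{n−1}} < ϑ_τ^{t₀,…,t_{m−1}}` iff either (i') `T_f(σ) <_{T_k} T_g(τ)`
for the strictly increasing `f : n → k` and `g : m → k` onto `k = |{s₀,…,t_{m−1}}|` with
`f i < g j ↔ s_i < t_j` and `g j < f i ↔ t_j < s_i`, together with `n = 0` or `s_{n−1} < t`;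
or (ii') `m > 0` and `s ≤ t_{m−1}`. -/
def tlt (D : PraeDilator) : ThT D → ThT D → Prop
  | .node n ss σ, .node m ts τ =>
    ((∃ (k : ℕ) (f : Fin n ↪o Fin k) (g : Fin m ↪o Fin k),
      (∀ (i : Fin n) (j : Fin m), f i < g j ↔ tlt D (ss i) (ts j)) ∧
      (∀ (i : Fin n) (j : Fin m), g j < f i ↔ tlt D (ts j) (ss i)) ∧
      (∀ p : Fin k, (∃ i, f i = p) ∨ (∃ j, g j = p)) ∧
      D.map f σ < D.map g τ) ∧
      (∀ h : 0 < n, tlt D (ss ⟨n - 1, Nat.sub_lt h Nat.one_pos⟩) (.node m ts τ))) ∨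
    (∃ h : 0 < m,
      tlt D (.node n ss σ) (ts ⟨m - 1, Nat.sub_lt h Nat.one_pos⟩) ∨
      ThT.node n ss σ = ts ⟨m - 1, Nat.sub_lt h Nat.one_pos⟩)
termination_by s t => tsizeT D s + tsizeT D t
decreasing_by
  · have h1 := tsizeT_lt D n ss σ i
    have h2 := tsizeT_lt D m ts τ j
    omega
  · have h1 := tsizeT_lt D m ts τ j
    have h2 := tsizeT_lt D n ss σ i
    omega
  · have h1 := tsizeT_lt D n ss σ ⟨n - 1, Nat.sub_lt h Nat.one_pos⟩
    omega
  · have h1 := tsizeT_lt D m ts τ ⟨m - 1, Nat.sub_lt h Nat.one_pos⟩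
    omega

/-- Well-formed terms of `ϑ(T)`: in `ϑ_σ^{s₀,…,s_{n−1}}` the listed terms must be
well-formed and strictly increasing, and `σ ∈ T_n` must have full support
`supp^T_n(σ) = {0,…,n−1}`. -/
inductive ThTWF (D : PraeDilator) : ThT D → Prop where
  | node (n : ℕ) (ss : Fin n → ThT D) (σ : D.A n) :
      (∀ i, ThTWF D (ss i)) → (∀ i j : Fin n, i < j → tlt D (ss i) (ss j)) →
      D.supp n σ = Finset.univ → ThTWF D (.node n ss σ)

/-- `θ : A → X` is a Bachmann-Howard collapse with respect to the relations `ltA`, `ltX` and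
the support function `supp`. -/
def IsBHCollapse {A X : Type} (ltA : A → A → Prop) (ltX : X → X → Prop)
    (supp : A → Finset X) (θ : A → X) : Prop :=
  (∀ σ τ : A, ltA σ τ → (∀ x ∈ supp σ, ltX x (θ τ)) → ltX (θ σ) (θ τ)) ∧
  (∀ σ : A, ∀ x ∈ supp σ, ltX x (θ σ))

/-- Transport along an equality of indices. -/
def castA (D : PraeDilator) {n m : ℕ} (h : n = m) (σ : D.A n) : D.A m := h ▸ σ

theorem supp_castA (D : PraeDilator) {n m : ℕ} (h : n = m) (σ : D.A n) :
    D.supp m (castA D h σ) = Finset.univ ↔ D.supp n σ = Finset.univ := by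
  subst h; rfl

/-- An element of `T_0` extracted from a term of `ϑ(T)` (used as a default value). -/
def leafTh (D : PraeDilator) : ThT D → D.A 0
  | .node 0 _ σ => σ
  | .node (n + 1) ss _ => leafTh D (ss 0)
termination_by t => tsizeT D t
decreasing_by
  exact tsizeT_lt D _ ss _ 0

/-- The default element `⟨∅, σ₀⟩` of `D^T_X` determined by `σ₀ ∈ T_0`. -/
def emptyDApp (D : PraeDilator) (X : Type) [LinearOrder X] (σ₀ : D.A 0) : DApp D X :=
  ⟨∅, castA D Finset.card_empty.symm σ₀, by
    apply Finset.eq_univ_of_forall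
    intro i
    have := i.isLt
    simp at this⟩

/-- The map `f : ϑ(T) → X` determined by a Bachmann-Howard collapse `ϑ : D^T_X → X`:
`f(ϑ_σ^{s₀,…,s_{n−1}}) = ϑ(⟨{f(s₀),…,f(s_{n−1})}, σ⟩)` (with an arbitrary default value in
the degenerate cases that cannot occur for well-formed terms). -/
def embTh (D : PraeDilator) {X : Type} [LinearOrder X] (θ : DApp D X → X) :
    ThT D → X
  | .node n ss σ =>
    let fs : Finset X := Finset.image (fun i => embTh D θ (ss i)) Finset.univ
    if h : fs.card = n ∧ D.supp n σ = Finset.univ then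
      θ ⟨fs, castA D h.1.symm σ, (supp_castA D h.1.symm σ).mpr h.2⟩
    else θ (emptyDApp D X (leafTh D (.node n ss σ)))
termination_by t => tsizeT D t
decreasing_by
  exact tsizeT_lt D _ ss _ i

/-- The element `⟨{e 0, …, e (n - 1)}, σ⟩` of `D^T_X`. -/
def rangeDApp (D : PraeDilator) {X : Type} [LinearOrder X] {n : ℕ} (e : Fin n → X)
    (he : StrictMono e) (σ : D.A n) (hσ : D.supp n σ = Finset.univ) : DApp D X :=
  have h : (Finset.image e Finset.univ).card = n := by
    rw [Finset.card_image_of_injective _ he.injective, Finset.card_fin]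
  ⟨Finset.image e Finset.univ, castA D h.symm σ, (supp_castA D h.symm σ).mpr hσ⟩

theorem map_castA (D : PraeDilator) {n m k : ℕ} (h : m = n) (ψ : Fin m ↪o Fin k) (σ : D.A n) :
    D.map ψ (castA D h.symm σ) =
      D.map ((Fin.castOrderIso h.symm).toOrderEmbedding.trans ψ) σ := by
  subst h
  rfl

theorem orderEmbOfFin_inclEmb {X : Type} [LinearOrder X] {a d : Finset X} (h : a ⊆ d)
    (i : Fin a.card) : d.orderEmbOfFin rfl (inclEmb h i) = a.orderEmbOfFin rfl i :=
  congrArg Subtype.val ((d.orderIsoOfFin rfl).apply_symm_apply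
    ⟨a.orderEmbOfFin rfl i, h (a.orderEmbOfFin_mem rfl i)⟩)

theorem orderEmbOfFin_image_cast {X : Type} [LinearOrder X] {n : ℕ} {e : Fin n → X}
    (he : StrictMono e) (h : (Finset.image e Finset.univ).card = n) (i : Fin n) :
    (Finset.image e Finset.univ).orderEmbOfFin rfl (Fin.cast h.symm i) = e i := by
  have := Finset.orderEmbOfFin_unique h (f := e) (fun x => by simp) he
  rw [congrFun this i]
  simp [Finset.orderEmbOfFin_apply]

/-- Finite increasing sequences `e` and `e'` can be merged, and the order between the elements
of `D^T_X` over their ranges is computed by the merging maps. -/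
theorem exists_merge (D : PraeDilator) {X : Type} [LinearOrder X] {n m : ℕ}
    {e : Fin n → X} {e' : Fin m → X} (he : StrictMono e) (he' : StrictMono e') :
    ∃ (k : ℕ) (f : Fin n ↪o Fin k) (g : Fin m ↪o Fin k),
      (∀ i j, f i < g j ↔ e i < e' j) ∧ (∀ i j, g j < f i ↔ e' j < e i) ∧
      (∀ p : Fin k, (∃ i, f i = p) ∨ (∃ j, g j = p)) ∧
      ∀ (σ : D.A n) (τ : D.A m) (hσ : D.supp n σ = Finset.univ)
        (hτ : D.supp m τ = Finset.univ),
        DLt D X (rangeDApp D e he σ hσ) (rangeDApp D e' he' τ hτ) ↔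
          D.map f σ < D.map g τ := by
  set a := Finset.image e Finset.univ with ha
  set b := Finset.image e' Finset.univ with hb
  have hca : a.card = n := by
    rw [ha, Finset.card_image_of_injective _ he.injective, Finset.card_fin]
  have hcb : b.card = m := by
    rw [hb, Finset.card_image_of_injective _ he'.injective, Finset.card_fin]
  let f := (Fin.castOrderIso hca.symm).toOrderEmbedding.trans
    (inclEmb (Finset.subset_union_left : a ⊆ a ∪ b))
  let g := (Fin.castOrderIso hcb.symm).toOrderEmbedding.trans
    (inclEmb (Finset.subset_union_right : b ⊆ a ∪ b))
  have hf : ∀ i, (a ∪ b).orderEmbOfFin rfl (f i) = e i := fun i =>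
    (orderEmbOfFin_inclEmb Finset.subset_union_left _).trans
      (orderEmbOfFin_image_cast he hca i)
  have hg : ∀ j, (a ∪ b).orderEmbOfFin rfl (g j) = e' j := fun j =>
    (orderEmbOfFin_inclEmb Finset.subset_union_right _).trans
      (orderEmbOfFin_image_cast he' hcb j)
  refine ⟨_, f, g, fun i j => ?_, fun i j => ?_, fun p => ?_, fun σ τ hσ hτ => ?_⟩
  · rw [← hf, ← hg, OrderEmbedding.lt_iff_lt]
  · rw [← hf, ← hg, OrderEmbedding.lt_iff_lt]
  · have hp := (a ∪ b).orderEmbOfFin_mem rfl p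
    rcases Finset.mem_union.mp hp with hp | hp
    · obtain ⟨i, -, hi⟩ := Finset.mem_image.mp hp
      exact Or.inl ⟨i, ((a ∪ b).orderEmbOfFin rfl).injective ((hf i).trans hi)⟩
    · obtain ⟨j, -, hj⟩ := Finset.mem_image.mp hp
      exact Or.inr ⟨j, ((a ∪ b).orderEmbOfFin rfl).injective ((hg j).trans hj)⟩
  · rw [← map_castA D hca, ← map_castA D hcb]
    rfl

/-- Two jointly surjective embeddings into `Fin k` are initial among pairs of embeddings that
compare elements in the same way. -/
theorem exists_factor {Y : Type} [LinearOrder Y] {n m k : ℕ} (f : Fin n ↪o Fin k)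
    (g : Fin m ↪o Fin k) (hfg : ∀ p : Fin k, (∃ i, f i = p) ∨ (∃ j, g j = p))
    (e : Fin n ↪o Y) (e' : Fin m ↪o Y) (h₁ : ∀ i j, f i < g j ↔ e i < e' j)
    (h₂ : ∀ i j, g j < f i ↔ e' j < e i) :
    ∃ h : Fin k ↪o Y, f.trans h = e ∧ g.trans h = e' := by
  have key : ∀ p : Fin k, ∃ y : Y, (∀ i, f i = p → e i = y) ∧ (∀ j, g j = p → e' j = y) := by
    have heq : ∀ i j, f i = g j → e i = e' j := fun i j hij =>
      le_antisymm (not_lt.mp fun hlt => ((h₂ i j).mpr hlt).ne' hij)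
        (not_lt.mp fun hlt => ((h₁ i j).mpr hlt).ne hij)
    intro p
    rcases hfg p with ⟨i, rfl⟩ | ⟨j, rfl⟩
    · exact ⟨e i, fun i' hi => by rw [f.injective hi], fun j hj => (heq i j hj.symm).symm⟩
    · exact ⟨e' j, fun i hi => heq i j hi, fun j' hj => by rw [g.injective hj]⟩
  choose h hh₁ hh₂ using key
  have hf : ∀ i, h (f i) = e i := fun i => (hh₁ _ i rfl).symm
  have hg : ∀ j, h (g j) = e' j := fun j => (hh₂ _ j rfl).symm
  have hmono : StrictMono h := by
    intro p q hpq
    rcases hfg p with ⟨i, rfl⟩ | ⟨j, rfl⟩ <;> rcases hfg q with ⟨i', rfl⟩ | ⟨j', rfl⟩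
    · rw [hf, hf]; exact e.lt_iff_lt.mpr (f.lt_iff_lt.mp hpq)
    · rw [hf, hg]; exact (h₁ _ _).mp hpq
    · rw [hg, hf]; exact (h₂ _ _).mp hpq
    · rw [hg, hg]; exact e'.lt_iff_lt.mpr (g.lt_iff_lt.mp hpq)
  exact ⟨OrderEmbedding.ofStrictMono h hmono, by ext i; exact hf i, by ext j; exact hg j⟩

theorem PraeDilator.map_injective (D : PraeDilator) {n m : ℕ} (f : Fin n ↪o Fin m) :
    Function.Injective (D.map f) :=
  StrictMono.injective (f := D.map f) fun σ τ h => D.map_strictMono f σ τ h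

theorem embTh_node (D : PraeDilator) {X : Type} [LinearOrder X] (θ : DApp D X → X) {n : ℕ}
    {ss : Fin n → ThT D} {σ : D.A n} (he : StrictMono fun i => embTh D θ (ss i))
    (hσ : D.supp n σ = Finset.univ) :
    embTh D θ (.node n ss σ) = θ (rangeDApp D (fun i => embTh D θ (ss i)) he σ hσ) := by
  have h : (Finset.image (fun i => embTh D θ (ss i)) Finset.univ).card = n := by
    rw [Finset.card_image_of_injective _ he.injective, Finset.card_fin]
  rw [embTh, dif_pos ⟨h, hσ⟩]
  rfl

theorem tsizeT_add_lt (D : PraeDilator) {n : ℕ} (ss : Fin n → ThT D) (σ : D.A n) {i j : Fin n}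
    (hij : i ≠ j) : tsizeT D (ss i) + tsizeT D (ss j) < tsizeT D (.node n ss σ) := by
  rw [tsizeT, Nat.lt_succ_iff, ← Finset.sum_pair (f := fun i => tsizeT D (ss i)) hij]
  exact Finset.sum_le_sum_of_subset (Finset.subset_univ _)

/-- Trichotomy of `<_{ϑ(T)}` for nodes, provided that the order between subterms is reflected
in `X` by the strictly increasing sequences `e` and `e'`. -/
theorem tlt_node_trichotomous (D : PraeDilator) {X : Type} [LinearOrder X] {n m : ℕ}
    {ss : Fin n → ThT D} {ts : Fin m → ThT D} {σ : D.A n} {τ : D.A m}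
    (hσ : D.supp n σ = Finset.univ) (hτ : D.supp m τ = Finset.univ)
    {e : Fin n → X} {e' : Fin m → X} (he : StrictMono e) (he' : StrictMono e')
    (hlt : ∀ i j, tlt D (ss i) (ts j) ↔ e i < e' j)
    (hgt : ∀ i j, tlt D (ts j) (ss i) ↔ e' j < e i)
    (heq : ∀ i j, e i = e' j → ss i = ts j)
    (hs : ∀ i, tlt D (ss i) (.node m ts τ) ∨ ss i = .node m ts τ ∨ tlt D (.node m ts τ) (ss i))
    (ht : ∀ j, tlt D (.node n ss σ) (ts j) ∨ .node n ss σ = ts j ∨ tlt D (ts j) (.node n ss σ)) :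
    tlt D (.node n ss σ) (.node m ts τ) ∨ ThT.node n ss σ = .node m ts τ ∨
      tlt D (.node m ts τ) (.node n ss σ) := by
  obtain ⟨k, f, g, h₁, h₂, hfg, -⟩ := exists_merge D he he'
  rcases lt_trichotomy (D.map f σ) (D.map g τ) with h | h | h
  · by_cases hn : ∀ hn : 0 < n, tlt D (ss ⟨n - 1, Nat.sub_lt hn Nat.one_pos⟩) (.node m ts τ)
    · left
      rw [tlt]
      exact Or.inl ⟨⟨k, f, g, fun i j => (h₁ i j).trans (hlt i j).symm,
        fun i j => (h₂ i j).trans (hgt i j).symm, hfg, h⟩, hn⟩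
    · obtain ⟨hn, hlast⟩ := not_forall.mp hn
      right; right
      rw [tlt]
      rcases (hs _).resolve_left hlast with h' | h'
      · exact Or.inr ⟨hn, Or.inr h'.symm⟩
      · exact Or.inr ⟨hn, Or.inl h'⟩
  · right; left
    have hr : Finset.univ.map f.toEmbedding = Finset.univ.map g.toEmbedding := by
      rw [← hσ, ← hτ, ← D.supp_natural, ← D.supp_natural, h]
    have hf : Function.Surjective f := by
      intro p
      rcases hfg p with hp | ⟨j, rfl⟩
      · exact hp
      · have : g j ∈ Finset.univ.map f.toEmbedding := by
          rw [hr]; exact Finset.mem_map_of_mem g.toEmbedding (Finset.mem_univ j)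
        simpa using this
    have hg : Function.Surjective g := by
      intro p
      rcases hfg p with ⟨i, rfl⟩ | hp
      · have : f i ∈ Finset.univ.map g.toEmbedding := by
          rw [← hr]; exact Finset.mem_map_of_mem f.toEmbedding (Finset.mem_univ i)
        simpa using this
      · exact hp
    obtain rfl : n = k := by
      simpa using Fintype.card_congr (Equiv.ofBijective f ⟨f.injective, hf⟩)
    obtain rfl : m = n := by
      simpa using Fintype.card_congr (Equiv.ofBijective g ⟨g.injective, hg⟩)
    have hfg' : f = g := by
      ext i
      have := Subsingleton.elim (RelIso.ofSurjective f hf) (RelIso.ofSurjective g hg)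
      exact congrArg Fin.val (DFunLike.congr_fun this i)
    subst hfg'
    obtain rfl := D.map_injective f h
    have : ss = ts := by
      ext i
      refine heq i i (le_antisymm (not_lt.mp fun hl => ?_) (not_lt.mp fun hl => ?_))
      · exact lt_irrefl _ ((h₂ i i).mpr hl)
      · exact lt_irrefl _ ((h₁ i i).mpr hl)
    rw [this]
  · by_cases hm : ∀ hm : 0 < m, tlt D (ts ⟨m - 1, Nat.sub_lt hm Nat.one_pos⟩) (.node n ss σ)
    · right; right
      rw [tlt]
      exact Or.inl ⟨⟨k, g, f, fun j i => (h₂ i j).trans (hgt i j).symm,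
        fun j i => (h₁ i j).trans (hlt i j).symm, fun p => (hfg p).symm, h⟩, hm⟩
    · obtain ⟨hm, hlast⟩ := not_forall.mp hm
      left
      rw [tlt]
      rcases ht ⟨m - 1, Nat.sub_lt hm Nat.one_pos⟩ with h' | h' | h'
      · exact Or.inr ⟨hm, Or.inl h'⟩
      · exact Or.inr ⟨hm, Or.inr h'⟩
      · exact absurd h' hlast

/-- On well-formed terms the relation `<_{ϑ(T)}` is trichotomous and `embTh` is strictly
increasing. -/
theorem tlt_trichotomous_and_embTh_lt (D : PraeDilator) {X : Type} [LinearOrder X]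
    (θ : DApp D X → X)
    (hθ : IsBHCollapse (DLt D X) ((· < ·) : X → X → Prop) (fun x => x.a) θ) (N : ℕ) :
    ∀ s t : ThT D, tsizeT D s + tsizeT D t < N → ThTWF D s → ThTWF D t →
      (tlt D s t ∨ s = t ∨ tlt D t s) ∧ (tlt D s t → embTh D θ s < embTh D θ t) := by
  induction N with
  | zero => intro s t h; omega
  | succ N ih =>
    have hiff : ∀ s t : ThT D, tsizeT D s + tsizeT D t < N → ThTWF D s → ThTWF D t →
        (tlt D s t ↔ embTh D θ s < embTh D θ t) := by
      intro s t h hs ht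
      refine ⟨(ih s t h hs ht).2, fun hlt => ?_⟩
      rcases (ih s t h hs ht).1 with h' | rfl | h'
      · exact h'
      · exact absurd hlt (lt_irrefl _)
      · exact absurd hlt ((ih t s (by omega) ht hs).2 h').asymm
    have heq : ∀ s t : ThT D, tsizeT D s + tsizeT D t < N → ThTWF D s → ThTWF D t →
        embTh D θ s = embTh D θ t → s = t := by
      intro s t h hs ht he
      rcases (ih s t h hs ht).1 with h' | h' | h'
      · exact absurd he ((ih s t h hs ht).2 h').ne
      · exact h'
      · exact absurd he ((ih t s (by omega) ht hs).2 h').ne'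
    rintro _ _ hN (⟨n, ss, σ, hss, hsm, hσ⟩) (⟨m, ts, τ, hts, htm, hτ⟩)
    have hsi := tsizeT_lt D n ss σ
    have htj := tsizeT_lt D m ts τ
    have he : StrictMono fun i => embTh D θ (ss i) := fun i j hij => by
      have := tsizeT_add_lt D ss σ hij.ne
      exact (ih _ _ (by omega) (hss i) (hss j)).2 (hsm i j hij)
    have he' : StrictMono fun i => embTh D θ (ts i) := fun i j hij => by
      have := tsizeT_add_lt D ts τ hij.ne
      exact (ih _ _ (by omega) (hts i) (hts j)).2 (htm i j hij)
    have hsize : ∀ i j, tsizeT D (ss i) + tsizeT D (ts j) < N := fun i j => by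
      have := hsi i
      have := htj j
      omega
    have hws := ThTWF.node n ss σ hss hsm hσ
    have hwt := ThTWF.node m ts τ hts htm hτ
    have hlt := fun i j => hiff _ _ (hsize i j) (hss i) (hts j)
    have hgt := fun i j => hiff (ts j) (ss i) (by have := hsize i j; omega) (hts j) (hss i)
    have hst := fun i => ih (ss i) _ (by have := hsi i; omega) (hss i) hwt
    have hts' := fun j => ih _ (ts j) (by have := htj j; omega) hws (hts j)
    refine ⟨tlt_node_trichotomous D hσ hτ he he' hlt hgt
      (fun i j => heq _ _ (hsize i j) (hss i) (hts j)) (fun i => (hst i).1)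
      (fun j => (hts' j).1), fun h => ?_⟩
    have hmem : ∀ j, embTh D θ (ts j) < embTh D θ (.node m ts τ) := fun j => by
      rw [embTh_node D θ he' hτ]
      exact hθ.2 _ _ (Finset.mem_image_of_mem _ (Finset.mem_univ j))
    rw [tlt] at h
    rcases h with ⟨⟨k, f, g, h₁, h₂, hfg, hk⟩, hlast⟩ | ⟨hm, h | h⟩
    · have hbound : ∀ i, embTh D θ (ss i) < embTh D θ (.node m ts τ) := fun i => by
        refine lt_of_le_of_lt (he.monotone ?_) ((hst _).2 (hlast i.pos))
        exact Nat.le_sub_one_of_lt i.isLt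
      obtain ⟨k', f', g', h₁', h₂', -, hD⟩ := exists_merge D he he'
      obtain ⟨h, rfl, rfl⟩ := exists_factor f g hfg f' g'
        (fun i j => (h₁ i j).trans ((hlt i j).trans (h₁' i j).symm))
        (fun i j => (h₂ i j).trans ((hgt i j).trans (h₂' i j).symm))
      rw [embTh_node D θ he hσ]
      rw [embTh_node D θ he' hτ] at hbound ⊢
      refine hθ.1 _ _ ((hD σ τ hσ hτ).mpr ?_) fun x hx => ?_
      · rw [D.map_comp, D.map_comp]
        exact D.map_strictMono h _ _ hk
      · obtain ⟨i, -, rfl⟩ := Finset.mem_image.mp hx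
        exact hbound i
    · exact ((hts' _).2 h).trans (hmem _)
    · rw [h]
      exact hmem _

/-- Let `T` be a coded prae-dilator, `X` a linear order and `ϑ : D^T_X → X` a
Bachmann-Howard collapse. Then the map `f : ϑ(T) → X` defined recursively by
`f(ϑ_σ^{s₀,…,s_{n−1}}) := ϑ(⟨{f(s₀),…,f(s_{n−1})}, σ⟩)` is strictly increasing on the terms
of `ϑ(T)`; that is, `ϑ(T)` embeds into every Bachmann-Howard fixed point of `T`. -/
theorem embTh_strictMono (D : PraeDilator) (X : Type) [LinearOrder X]
    (θ : DApp D X → X)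
    (hθ : IsBHCollapse (DLt D X) ((· < ·) : X → X → Prop) (fun x => x.a) θ) :
    ∀ s t : ThT D, ThTWF D s → ThTWF D t → tlt D s t → embTh D θ s < embTh D θ t := by
  exact fun s t hs ht =>
    (tlt_trichotomous_and_embTh_lt D θ hθ _ s t (Nat.lt_succ_self _) hs ht).2
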